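/- Let X ∈ ℝ^{n×p} be a design matrix, x ∈ ℝ^n a response vector, θ̃* ∈ ℝ^p an arbitrary (possibly non-sparse) target vector, and J ⊆ {1,…,p} an index set with |J| ≤ k (k ≥ 1); write b := ‖θ̃*_{J^c}‖₁ for the ℓ₁ norm of θ̃* restricted to the complement of J. Suppose Σ̂ = XᵀX/n satisfies the restricted eigenvalue condition RE(α, τ) with curvature α > 0 and tolerance τ = ((m−1)/m)·α/(32k) for some m > 1, and that ‖(1/n)·Xᵀ(x − Xθ̃*)‖_∞ ≤ λ/4 for some λ > 0. Then any minimizer θ̂ of the LASSO objective (1/n)‖x − Xθ‖₂² + λ‖θ‖₁ satisfies: (i) ‖θ̂ − θ̃*‖₂ ≤ (3/2)·λ√k/(α/m) + √(2m/k)·b + √((4λ/(α/m))·b); (ii) ‖θ̂ − θ̃*‖₁ ≤ 6·λk/(α/m) + 4(√(2m)+1)·b + 8·√(λk/(α/m))·√b; and (iii) (1/n)(θ̂ − θ̃*)ᵀXᵀX(θ̂ − θ̃*) ≤ 9·λ²k/(α/m) + (6(√(2m)+1)+2)·λ·b + 12·√(λ³k/(α/m))·√b. -/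

import Mathlib

open Matrix Finset

/-- The ℓ₁ norm of a finite-dimensional real vector. -/
noncomputable def l1norm {d : ℕ} (v : Fin d → ℝ) : ℝ := ∑ i, |v i|

/-- The Euclidean (ℓ₂) norm of a finite-dimensional real vector. -/
noncomputable def l2norm {d : ℕ} (v : Fin d → ℝ) : ℝ := Real.sqrt (∑ i, (v i) ^ 2)

lemma aux_l2sq {d : ℕ} (v : Fin d → ℝ) : (l2norm v) ^ 2 = v ⬝ᵥ v := by
  unfold l2norm
  rw [Real.sq_sqrt (Finset.sum_nonneg fun i _ => sq_nonneg _)]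
  simp [dotProduct, sq]

lemma aux_quad (s A B : ℝ) (hA : 0 ≤ A) (hB : 0 ≤ B) (h : s ^ 2 ≤ A * s + B) :
    s ≤ A + √B := by
  by_contra hc
  push Not at hc
  have h1 := Real.sqrt_nonneg B
  have h2 := Real.sq_sqrt hB
  nlinarith [mul_nonneg hA h1]

lemma aux_real (k a m lam b s c d Q : ℝ) (hk : 0 < k) (ha : 0 < a) (hm : 1 < m)
    (hlam : 0 < lam) (hb : 0 ≤ b) (hs : 0 ≤ s) (hc : 0 ≤ c) (hd : 0 ≤ d) (hQ : 0 ≤ Q)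
    (hcs : c ≤ √k * s)
    (hbasic : Q ≤ 3 / 2 * lam * c - 1 / 2 * lam * d + 2 * lam * b)
    (hRE : m * a * s ^ 2 - ((m - 1) * (a / (32 * k))) * (c + d) ^ 2 ≤ Q) :
    s ≤ (3 / 2) * (lam * √k) / a + √(2 * m / k) * b + √((4 * lam / a) * b) ∧
    c + d ≤ 6 * (lam * k) / a + 4 * (√(2 * m) + 1) * b + 8 * √(lam * k / a) * √b ∧
    Q ≤ 9 * (lam ^ 2 * k) / a + (6 * (√(2 * m) + 1) + 2) * lam * b
          + 12 * √(lam ^ 3 * k / a) * √b := by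
  have hsk := Real.sq_sqrt hk.le
  have hsk0 : 0 < √k := Real.sqrt_pos.2 hk
  have hdc : d ≤ 3 * c + 4 * b := by
    have : lam * d ≤ lam * (3 * c + 4 * b) := by nlinarith
    exact le_of_mul_le_mul_left this hlam
  have hL : c + d ≤ 4 * (√k * s) + 4 * b := by linarith
  have hL2 : (c + d) ^ 2 ≤ 32 * k * s ^ 2 + 32 * b ^ 2 := by
    have h1 : (c + d) ^ 2 ≤ (4 * (√k * s) + 4 * b) ^ 2 :=
      pow_le_pow_left₀ (by positivity) hL 2
    have h2 : (√k * s) ^ 2 = k * s ^ 2 := by rw [mul_pow, hsk]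
    nlinarith [sq_nonneg (√k * s - b)]
  have hT : ((m - 1) * (a / (32 * k))) * (c + d) ^ 2
      ≤ (m - 1) * a * s ^ 2 + (m - 1) * a * b ^ 2 / k := by
    calc _ ≤ ((m - 1) * (a / (32 * k))) * (32 * k * s ^ 2 + 32 * b ^ 2) := by
          have : 0 ≤ m - 1 := by linarith
          gcongr
      _ = _ := by field_simp
  have hq : s ^ 2 ≤ ((3 / 2) * (lam * √k) / a) * s + (2 * m / k * b ^ 2 + 4 * lam / a * b) := by
    have h1 : a * s ^ 2 ≤ 3 / 2 * lam * (√k * s) + 2 * lam * b + (m - 1) * a * b ^ 2 / k := by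
      nlinarith [mul_le_mul_of_nonneg_left hcs hlam.le, mul_nonneg hlam.le hd]
    have h2 : (m - 1) * a * b ^ 2 / k ≤ (2 * m) * a * b ^ 2 / k := by
      gcongr; linarith
    have h3 : 0 ≤ lam * b := by positivity
    have h4 : a * s ^ 2 ≤ a * (((3 / 2) * (lam * √k) / a) * s + (2 * m / k * b ^ 2 + 4 * lam / a * b)) := by
      have : a * (((3 / 2) * (lam * √k) / a) * s + (2 * m / k * b ^ 2 + 4 * lam / a * b))
        = 3 / 2 * lam * (√k * s) + 4 * (lam * b) + (2 * m) * a * b ^ 2 / k := by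
        field_simp; ring
      rw [this]; linarith
    exact le_of_mul_le_mul_left h4 ha
  have hi := aux_quad _ _ _ (by positivity) (by positivity) hq
  have hsplit : √(2 * m / k * b ^ 2 + 4 * lam / a * b) ≤ √(2 * m / k) * b + √((4 * lam / a) * b) := by
    have h1 : 0 ≤ 2 * m / k := by positivity
    have h2 : 0 ≤ 4 * lam / a * b := by positivity
    apply Real.sqrt_le_iff.2 ⟨by positivity, ?_⟩
    rw [add_sq, mul_pow, Real.sq_sqrt h1, Real.sq_sqrt h2]
    have : 0 ≤ 2 * (√(2 * m / k) * b) * √(4 * lam / a * b) := by positivity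
    linarith
  have H1 : s ≤ (3 / 2) * (lam * √k) / a + √(2 * m / k) * b + √((4 * lam / a) * b) := by linarith
  have e1 : √k * √(2 * m / k) = √(2 * m) := by
    rw [← Real.sqrt_mul hk.le]; congr 1; field_simp
  have e2 : √k * √((4 * lam / a) * b) = 2 * √(lam * k / a) * √b := by
    rw [← Real.sqrt_mul hk.le, mul_assoc, ← Real.sqrt_mul (by positivity)]
    have : k * (4 * lam / a * b) = 2 ^ 2 * (lam * k / a * b) := by ring
    rw [this, Real.sqrt_mul (by positivity), Real.sqrt_sq (by norm_num)]
  have H2 : c + d ≤ 6 * (lam * k) / a + 4 * (√(2 * m) + 1) * b + 8 * √(lam * k / a) * √b := by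
    have h1 := mul_le_mul_of_nonneg_left H1 hsk0.le
    have h2 : √k * ((3 / 2) * (lam * √k) / a + √(2 * m / k) * b + √((4 * lam / a) * b))
       = 3 / 2 * (lam * k) / a + √(2 * m) * b + 2 * √(lam * k / a) * √b := by
      rw [mul_add, mul_add, e2, ← mul_assoc (√k) (√(2 * m / k)) b, e1]
      have h5 : √k * ((3 / 2) * (lam * √k) / a) = 3 / 2 * (lam * (√k) ^ 2) / a := by ring
      rw [h5, hsk]
    rw [h2] at h1
    have h3 : 6 * (lam * k) / a = 4 * (3 / 2 * (lam * k) / a) := by ring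
    rw [h3]; linarith
  refine ⟨H1, H2, ?_⟩
  have e3 : √(lam ^ 3 * k / a) = lam * √(lam * k / a) := by
    have : lam ^ 3 * k / a = lam ^ 2 * (lam * k / a) := by ring
    rw [this, Real.sqrt_mul (by positivity), Real.sqrt_sq hlam.le]
  rw [e3]
  have h1 := mul_le_mul_of_nonneg_left H2 hlam.le
  have h2 : 9 * (lam ^ 2 * k) / a = 3 / 2 * (lam * (6 * (lam * k) / a)) := by ring
  rw [h2]
  nlinarith [mul_nonneg hlam.le hd]

/-- Proposition 4: prediction error bounds for the LASSO with a weakly sparse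
(possibly non-sparse) target `θtil`, support set `J` with |J| ≤ k, and
compressibility level b = ‖θtil_{Jᶜ}‖₁. -/
theorem lasso_prediction_error_reduced_model
    {n p k : ℕ} (hn : 0 < n) (hk : 1 ≤ k)
    (X : Matrix (Fin n) (Fin p) ℝ) (x : Fin n → ℝ)
    (θtil θhat : Fin p → ℝ)
    (J : Finset (Fin p)) (hJ : J.card ≤ k)
    (α m lam : ℝ) (hα : 0 < α) (hm : 1 < m) (hlam : 0 < lam)
    -- restricted eigenvalue condition RE(α, τ) for Σ̂ = XᵀX/n,
    -- with τ = ((m−1)/m)·α/(32k)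
    (hRE : ∀ φ : Fin p → ℝ,
      φ ⬝ᵥ (((1 / (n : ℝ)) • (Xᵀ * X)) *ᵥ φ) ≥
        α * (l2norm φ) ^ 2 - ((m - 1) / m * (α / (32 * k))) * (l1norm φ) ^ 2)
    -- deviation bound: ‖(1/n)·Xᵀ(x − Xθ̃*)‖_∞ ≤ λ/4
    (hdev : ∀ i : Fin p, |(1 / (n : ℝ)) * (Xᵀ *ᵥ (x - X *ᵥ θtil)) i| ≤ lam / 4)
    -- θ̂ minimizes the LASSO objective
    (hmin : ∀ θ : Fin p → ℝ,
      (1 / (n : ℝ)) * (l2norm (x - X *ᵥ θhat)) ^ 2 + lam * l1norm θhat ≤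
        (1 / (n : ℝ)) * (l2norm (x - X *ᵥ θ)) ^ 2 + lam * l1norm θ) :
    -- b := ‖θ̃*_{Jᶜ}‖₁
    l2norm (θhat - θtil) ≤
        (3 / 2) * (lam * Real.sqrt k) / (α / m)
          + Real.sqrt (2 * m / k) * (∑ i ∈ Jᶜ, |θtil i|)
          + Real.sqrt ((4 * lam / (α / m)) * (∑ i ∈ Jᶜ, |θtil i|)) ∧
    l1norm (θhat - θtil) ≤
        6 * (lam * k) / (α / m)
          + 4 * (Real.sqrt (2 * m) + 1) * (∑ i ∈ Jᶜ, |θtil i|)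
          + 8 * Real.sqrt (lam * k / (α / m)) * Real.sqrt (∑ i ∈ Jᶜ, |θtil i|) ∧
    (1 / (n : ℝ)) * ((θhat - θtil) ⬝ᵥ ((Xᵀ * X) *ᵥ (θhat - θtil))) ≤
        9 * (lam ^ 2 * k) / (α / m)
          + (6 * (Real.sqrt (2 * m) + 1) + 2) * lam * (∑ i ∈ Jᶜ, |θtil i|)
          + 12 * Real.sqrt (lam ^ 3 * k / (α / m)) * Real.sqrt (∑ i ∈ Jᶜ, |θtil i|) := by
  have hn' : (0 : ℝ) < n := by exact_mod_cast hn
  have hk' : (0 : ℝ) < k := by exact_mod_cast hk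
  obtain ⟨v, hv⟩ : ∃ v, v = θhat - θtil := ⟨_, rfl⟩
  have hθ : θhat = θtil + v := by rw [hv]; abel
  rw [← hv]
  have hsplit1 : ∀ f : Fin p → ℝ, ∑ i, f i = ∑ i ∈ J, f i + ∑ i ∈ Jᶜ, f i :=
    fun f => (Finset.sum_add_sum_compl J f).symm
  have hl1 : l1norm v = ∑ i ∈ J, |v i| + ∑ i ∈ Jᶜ, |v i| := hsplit1 _
  have hXX : v ⬝ᵥ ((Xᵀ * X) *ᵥ v) = (X *ᵥ v) ⬝ᵥ (X *ᵥ v) := by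
    rw [← Matrix.mulVec_mulVec, Matrix.dotProduct_mulVec, Matrix.vecMul_transpose]
  have hQ0 : 0 ≤ (1 / (n : ℝ)) * (v ⬝ᵥ ((Xᵀ * X) *ᵥ v)) := by
    rw [hXX, ← aux_l2sq]; positivity
  have hcross : (1 / (n : ℝ)) * ((x - X *ᵥ θtil) ⬝ᵥ (X *ᵥ v)) ≤ lam / 4 * l1norm v := by
    rw [Matrix.dotProduct_mulVec, ← Matrix.mulVec_transpose, dotProduct, Finset.mul_sum, l1norm,
      Finset.mul_sum]
    apply Finset.sum_le_sum
    intro i _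
    rw [← mul_assoc]
    refine (le_abs_self _).trans ?_
    rw [abs_mul]
    exact mul_le_mul_of_nonneg_right (hdev i) (abs_nonneg _)
  have hpen : l1norm θtil - l1norm θhat ≤
      ∑ i ∈ J, |v i| - ∑ i ∈ Jᶜ, |v i| + 2 * ∑ i ∈ Jᶜ, |θtil i| := by
    have h1 : ∑ i ∈ J, |θtil i| ≤ ∑ i ∈ J, |θhat i| + ∑ i ∈ J, |v i| := by
      rw [← Finset.sum_add_distrib]
      apply Finset.sum_le_sum
      intro i _
      have : θtil i = θhat i - v i := by rw [hθ]; simp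
      rw [this]; exact abs_sub _ _
    have h2 : ∑ i ∈ Jᶜ, |v i| ≤ ∑ i ∈ Jᶜ, |θhat i| + ∑ i ∈ Jᶜ, |θtil i| := by
      rw [← Finset.sum_add_distrib]
      apply Finset.sum_le_sum
      intro i _
      rw [hv]; exact abs_sub _ _
    have h3 : l1norm θtil = _ := hsplit1 _
    have h4 : l1norm θhat = _ := hsplit1 _
    rw [h3, h4]; linarith
  have hm0 := hmin θtil
  have hexp : (l2norm (x - X *ᵥ θhat)) ^ 2 = (l2norm (x - X *ᵥ θtil)) ^ 2
      - 2 * ((x - X *ᵥ θtil) ⬝ᵥ (X *ᵥ v)) + v ⬝ᵥ ((Xᵀ * X) *ᵥ v) := by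
    have : x - X *ᵥ θhat = (x - X *ᵥ θtil) - X *ᵥ v := by
      rw [hθ, Matrix.mulVec_add]; abel
    rw [aux_l2sq, aux_l2sq, hXX, this]
    generalize x - X *ᵥ θtil = e
    rw [sub_dotProduct, dotProduct_sub, dotProduct_sub, dotProduct_comm (X *ᵥ v) e]
    ring
  rw [hexp] at hm0
  have hbasic : (1 / (n : ℝ)) * (v ⬝ᵥ ((Xᵀ * X) *ᵥ v)) ≤ 3 / 2 * lam * (∑ i ∈ J, |v i|)
      - 1 / 2 * lam * (∑ i ∈ Jᶜ, |v i|) + 2 * lam * ∑ i ∈ Jᶜ, |θtil i| := by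
    have := mul_le_mul_of_nonneg_left hpen hlam.le
    rw [hl1] at hcross
    linarith
  have hcs : ∑ i ∈ J, |v i| ≤ √(k : ℝ) * l2norm v := by
    unfold l2norm
    rw [← Real.sqrt_mul hk'.le]
    apply Real.le_sqrt_of_sq_le
    refine (sq_sum_le_card_mul_sum_sq (s := J) (f := fun i => |v i|)).trans ?_
    simp only [sq_abs]
    have h1 : ∑ i ∈ J, v i ^ 2 ≤ ∑ i, v i ^ 2 :=
      Finset.sum_le_sum_of_subset_of_nonneg (Finset.subset_univ _) fun i _ _ => sq_nonneg _
    have h2 : (J.card : ℝ) ≤ k := by exact_mod_cast hJ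
    gcongr
  have hR := hRE v
  rw [Matrix.smul_mulVec, dotProduct_smul, smul_eq_mul, hl1] at hR
  rw [hl1]
  have hm1 : 0 < m := by linarith
  refine aux_real k (α / m) m lam _ (l2norm v) _ _ _ hk' (by positivity) hm hlam
    (Finset.sum_nonneg fun i _ => abs_nonneg _) (Real.sqrt_nonneg _)
    (Finset.sum_nonneg fun i _ => abs_nonneg _) (Finset.sum_nonneg fun i _ => abs_nonneg _)
    hQ0 hcs hbasic ?_
  refine le_trans (le_of_eq ?_) hR
  field_simp
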